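/- Let S = ⊕_{i≥0} S^i be a commutative Noetherian ℕ-graded ring with S⁰ = ℚ, let W be a finite group acting on S by degree-preserving ring automorphisms, and let R = S^W be the invariant subring (a graded subring of S); assume S is finitely generated as an R-module. Let M be a finitely generated graded S-module equipped with an action of W by degree-preserving additive automorphisms satisfying w(s·x) = w(s)·w(x) for all w ∈ W, s ∈ S, x ∈ M. If M is Cohen-Macaulay as an S-module, then the invariant module M^W is Cohen-Macaulay as an R-module. -/

import Mathlib

noncomputable def moduleDepth (R : Type*) [CommRing R] (I : Ideal R)
    (M : Type*) [AddCommGroup M] [Module R M] : ℕ∞ :=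
  sSup {n : ℕ∞ | ∃ rs : List R, (∀ r ∈ rs, r ∈ I) ∧
    RingTheory.Sequence.IsRegular M rs ∧ (rs.length : ℕ∞) = n}

noncomputable def moduleDim (R : Type*) [CommRing R]
    (M : Type*) [AddCommGroup M] [Module R M] : WithBot ℕ∞ :=
  ringKrullDim (R ⧸ Module.annihilator R M)

def IsCohenMacaulayModule (R : Type*) [CommRing R] (I : Ideal R)
    (M : Type*) [AddCommGroup M] [Module R M] : Prop :=
  Subsingleton M ∨ (moduleDepth R I M : WithBot ℕ∞) = moduleDim R M

/-- The subring of invariants `S^W` of a group `W` acting on a commutative ring `S`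
by ring automorphisms. -/
def fixedSubring (W S : Type*) [Group W] [CommRing S] [MulSemiringAction W S] :
    Subring S where
  carrier := {s : S | ∀ w : W, w • s = s}
  zero_mem' := fun w => by simp
  one_mem' := fun w => by simp
  add_mem' := by intro a b ha hb w; rw [smul_add, ha w, hb w]
  mul_mem' := by intro a b ha hb w; rw [smul_mul', ha w, hb w]
  neg_mem' := by intro a ha w; rw [smul_neg, ha w]

/-- The module of invariants `M^W` of a `W`-action on an `S`-module `M` compatible with
the `W`-action on `S`, as a module over the invariant subring `S^W`. -/
def fixedSubmodule (W S M : Type*) [Group W] [CommRing S] [MulSemiringAction W S]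
    [AddCommGroup M] [Module S M] [DistribMulAction W M]
    (hc : ∀ (w : W) (s : S) (x : M), w • (s • x) = (w • s) • (w • x)) :
    Submodule (fixedSubring W S) M where
  carrier := {x : M | ∀ w : W, w • x = x}
  zero_mem' := fun w => by simp
  add_mem' := by intro a b ha hb w; rw [smul_add, ha w, hb w]
  smul_mem' := by
    rintro ⟨s, hs⟩ x hx w
    show w • (s • x) = s • x
    rw [hc, hs w, hx w]

section RegularSequences

open RingTheory.Sequence Pointwise

variable {S : Type*} [CommRing S]

/-- The canonical isomorphism `(M/yM)/x(M/yM) ≃ (M/xM)/y(M/xM)`. -/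
noncomputable def QuotSMulTop.swap (x y : S) (M : Type*) [AddCommGroup M] [Module S M] :
    QuotSMulTop x (QuotSMulTop y M) ≃ₗ[S] QuotSMulTop y (QuotSMulTop x M) :=
  equivQuotTensor x _ ≪≫ₗ (equivQuotTensor y M).lTensor _ ≪≫ₗ
    TensorProduct.leftComm S _ _ M ≪≫ₗ
    ((equivQuotTensor x M).lTensor _).symm ≪≫ₗ (equivQuotTensor y _).symm

lemma isSMulRegular_quotSMulTop_iff {M : Type*} [AddCommGroup M] [Module S M] {x z : S} :
    IsSMulRegular (QuotSMulTop x M) z ↔ ∀ u v : M, z • u = x • v → ∃ v', u = x • v' := by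
  rw [isSMulRegular_quotient_iff_mem_of_smul_mem]
  simp only [Submodule.mem_smul_pointwise_iff_exists, Submodule.mem_top, true_and]
  exact ⟨fun h u v huv ↦ (h u ⟨v, huv.symm⟩).imp fun _ ↦ Eq.symm,
    fun h u ⟨v, huv⟩ ↦ (h u v huv.symm).imp fun _ ↦ Eq.symm⟩

lemma isSMulRegular_quotSMulTop_swap {M : Type*} [AddCommGroup M] [Module S M] {x z : S}
    (h : IsSMulRegular (QuotSMulTop x M) z) (hx : IsSMulRegular M x) :
    IsSMulRegular (QuotSMulTop z M) x := by
  rw [isSMulRegular_quotSMulTop_iff] at h ⊢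
  intro u v huv
  obtain ⟨w, rfl⟩ := h v u huv.symm
  exact ⟨w, hx (by simp only [huv, smul_comm z x w])⟩

/-- For two `M`-regular elements `x`, `y` of an ideal `I`, the ideal kills a nonzero element of
`M/yM` only if it kills one of `M/xM`. -/
lemma eq_zero_of_smul_eq_zero_quotSMulTop {M : Type*} [AddCommGroup M] [Module S M] {I : Ideal S}
    {x y : S} (hxI : x ∈ I) (hx : IsSMulRegular M x) (hy : IsSMulRegular M y)
    (h : ∀ m : QuotSMulTop x M, (∀ r ∈ I, r • m = 0) → m = 0)
    (m : QuotSMulTop y M) (hm : ∀ r ∈ I, r • m = 0) : m = 0 := by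
  obtain ⟨u, rfl⟩ := Submodule.Quotient.mk_surjective _ m
  simp only [← Submodule.Quotient.mk_smul, Submodule.Quotient.mk_eq_zero,
    Submodule.mem_smul_pointwise_iff_exists, Submodule.mem_top, true_and] at hm ⊢
  obtain ⟨v, hv⟩ := hm x hxI
  have key : (Submodule.Quotient.mk v : QuotSMulTop x M) = 0 := by
    refine h _ fun r hr ↦ ?_
    obtain ⟨t, ht⟩ := hm r hr
    simp only [← Submodule.Quotient.mk_smul, Submodule.Quotient.mk_eq_zero,
      Submodule.mem_smul_pointwise_iff_exists, Submodule.mem_top, true_and]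
    refine ⟨t, hy ?_⟩
    simp only
    rw [smul_comm y x t, ht, smul_comm y r v, hv, smul_comm]
  rw [Submodule.Quotient.mk_eq_zero, Submodule.mem_smul_pointwise_iff_exists] at key
  obtain ⟨w, -, rfl⟩ := key
  exact ⟨w, hx (by simpa only [smul_comm x y w] using hv)⟩

variable [IsNoetherianRing S]

/-- Prime avoidance: an ideal without regular elements is contained in an associated prime. -/
lemma exists_isSMulRegular_or_exists_le_associatedPrime {R : Type*} [CommRing R] [Algebra R S]
    (J : Ideal R) (M : Type*) [AddCommGroup M] [Module S M] [Module.Finite S M] :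
    (∃ r ∈ J, IsSMulRegular M (algebraMap R S r)) ∨
      ∃ P ∈ associatedPrimes S M, J.map (algebraMap R S) ≤ P := by
  by_contra! h
  have hfin := associatedPrimes.finite S M
  have hsub : (J : Set R) ⊆ ⋃ P ∈ (↑hfin.toFinset : Set (Ideal S)), P.comap (algebraMap R S) := by
    intro r hr
    have : algebraMap R S r ∈ {r : S | IsSMulRegular M r}ᶜ := h.1 r hr
    rw [← biUnion_associatedPrimes_eq_compl_regular S M] at this
    simpa using this
  rw [Ideal.subset_union_prime ⊥ ⊥] at hsub
  · obtain ⟨P, hP, hJP⟩ := hsub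
    exact h.2 P (by simpa using hP) (Ideal.map_le_iff_le_comap.mpr hJP)
  · intro P hP _ _
    have : P.IsPrime := IsAssociatedPrime.isPrime (hfin.mem_toFinset.mp hP)
    exact Ideal.comap_isPrime _ _

lemma exists_ne_zero_of_mem_associatedPrimes {M : Type*} [AddCommGroup M] [Module S M]
    {P : Ideal S} (hP : P ∈ associatedPrimes S M) : ∃ m : M, m ≠ 0 ∧ ∀ r ∈ P, r • m = 0 := by
  obtain ⟨hprime, m, hm⟩ := (isAssociatedPrime_iff (R := S)).mp hP
  refine ⟨m, ?_, fun r hr ↦ by simpa [hm] using hr⟩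
  rintro rfl
  exact hprime.ne_top (hm.trans (by ext; simp))

lemma exists_mem_isSMulRegular {I : Ideal S} {M : Type*} [AddCommGroup M] [Module S M]
    [Module.Finite S M] (h : ∀ m : M, (∀ r ∈ I, r • m = 0) → m = 0) :
    ∃ r ∈ I, IsSMulRegular M r := by
  refine (exists_isSMulRegular_or_exists_le_associatedPrime (R := S) I M).resolve_right ?_
  rintro ⟨P, hP, hIP⟩
  obtain ⟨m, hm, hPm⟩ := exists_ne_zero_of_mem_associatedPrimes hP
  exact hm (h m fun r hr ↦ hPm r (hIP (Ideal.mem_map_of_mem _ hr)))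

/-- If an ideal `I` contains a weakly `M`-regular sequence of length `n + 1`, then for every
`M`-regular `y ∈ I` it contains a weakly `M/yM`-regular sequence of length `n`. -/
lemma exists_isWeaklyRegular_quotSMulTop {I : Ideal S} (n : ℕ) (M : Type*) [AddCommGroup M]
    [Module S M] [Module.Finite S M] (rs : List S) (hrs : ∀ r ∈ rs, r ∈ I)
    (hreg : IsWeaklyRegular M rs) (hlen : rs.length = n + 1)
    {y : S} (hyI : y ∈ I) (hy : IsSMulRegular M y) :
    ∃ ts : List S, (∀ r ∈ ts, r ∈ I) ∧ IsWeaklyRegular (QuotSMulTop y M) ts ∧ ts.length = n := by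
  induction n generalizing M rs y with
  | zero => exact ⟨[], by simp⟩
  | succ n ih =>
    obtain _ | ⟨x, _ | ⟨x', t⟩⟩ := rs
    · simp at hlen
    · simp at hlen
    simp only [List.mem_cons, forall_eq_or_imp] at hrs
    rw [isWeaklyRegular_cons_iff] at hreg
    obtain ⟨hx, hreg⟩ := hreg
    have hkx : ∀ m : QuotSMulTop x M, (∀ r ∈ I, r • m = 0) → m = 0 := fun m hm ↦
      ((isWeaklyRegular_cons_iff _ _ _).mp hreg).1.right_eq_zero_of_smul (hm x' hrs.2.1)
    have hky := eq_zero_of_smul_eq_zero_quotSMulTop hrs.1 hx hy hkx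
    obtain ⟨z, hzI, hz⟩ : ∃ z ∈ I, IsSMulRegular (QuotSMulTop x M × QuotSMulTop y M) z := by
      refine exists_mem_isSMulRegular fun m hm ↦ ?_
      simp only [Prod.ext_iff] at hm ⊢
      exact ⟨hkx _ fun r hr ↦ (hm r hr).1, hky _ fun r hr ↦ (hm r hr).2⟩
    have hzx : IsSMulRegular (QuotSMulTop x M) z := fun a b hab ↦
      congrArg Prod.fst (hz (a₁ := (a, 0)) (a₂ := (b, 0)) (by simpa using hab))
    have hzy : IsSMulRegular (QuotSMulTop y M) z := fun a b hab ↦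
      congrArg Prod.snd (hz (a₁ := (0, a)) (a₂ := (0, b)) (by simpa using hab))
    obtain ⟨ts, htsI, hts, htl⟩ := ih (QuotSMulTop x M) (x' :: t)
      (by simpa using hrs.2) hreg (by simpa using hlen) hzI hzx
    rw [(QuotSMulTop.swap z x M).isWeaklyRegular_congr] at hts
    obtain ⟨us, husI, hus, hul⟩ := ih (QuotSMulTop z M) (x :: ts)
      (by simpa using ⟨hrs.1, htsI⟩) (hts.cons (isSMulRegular_quotSMulTop_swap hzx hx))
      (by simpa using htl) hyI (isSMulRegular_quotSMulTop_swap hzy hy)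
    rw [(QuotSMulTop.swap y z M).isWeaklyRegular_congr] at hus
    exact ⟨z :: us, by simpa using ⟨hzI, husI⟩, hus.cons hzy, by simpa using hul⟩

/-- Weakly regular sequences in an ideal `I` of `S` can be replaced by weakly regular sequences of
the same length coming from an ideal `J` of `R` such that `JS` and `I` have the same radical. -/
lemma exists_isWeaklyRegular_map_algebraMap {R : Type*} [CommRing R] [Algebra R S] {I : Ideal S}
    {J : Ideal R} (hJI : J.map (algebraMap R S) ≤ I)
    (hIJ : ∀ P : Ideal S, P.IsPrime → J.map (algebraMap R S) ≤ P → I ≤ P)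
    (n : ℕ) (M : Type*) [AddCommGroup M] [Module S M] [Module.Finite S M] (rs : List S)
    (hrs : ∀ r ∈ rs, r ∈ I) (hreg : IsWeaklyRegular M rs) (hlen : rs.length = n) :
    ∃ ts : List R, (∀ r ∈ ts, r ∈ J) ∧ IsWeaklyRegular M (ts.map (algebraMap R S)) ∧
      ts.length = n := by
  induction n generalizing M rs with
  | zero => exact ⟨[], by simp⟩
  | succ n ih =>
    obtain _ | ⟨x, t⟩ := rs
    · simp at hlen
    obtain ⟨y, hyJ, hy⟩ : ∃ y ∈ J, IsSMulRegular M (algebraMap R S y) := by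
      refine (exists_isSMulRegular_or_exists_le_associatedPrime J M).resolve_right ?_
      rintro ⟨P, hP, hJP⟩
      obtain ⟨m, hm, hPm⟩ := exists_ne_zero_of_mem_associatedPrimes hP
      refine hm (((isWeaklyRegular_cons_iff _ _ _).mp hreg).1.right_eq_zero_of_smul (hPm x ?_))
      exact hIJ P (IsAssociatedPrime.isPrime hP) hJP (hrs x (by simp))
    obtain ⟨us, husI, hus, hul⟩ := exists_isWeaklyRegular_quotSMulTop n M (x :: t) hrs hreg hlen
      (hJI (Ideal.mem_map_of_mem _ hyJ)) hy
    obtain ⟨ts, htsJ, hts, htl⟩ := ih _ us husI hus hul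
    exact ⟨y :: ts, by simpa using ⟨hyJ, htsJ⟩, by simpa using ⟨hy, hts⟩, by simpa using htl⟩

end RegularSequences

section Retracts

open RingTheory.Sequence

variable {R : Type*} [CommRing R]

/-- Weakly regular sequences on a module are weakly regular on its retracts. -/
lemma RingTheory.Sequence.IsWeaklyRegular.of_retract {A B : Type*} [AddCommGroup A] [Module R A]
    [AddCommGroup B] [Module R B] (i : A →ₗ[R] B) (p : B →ₗ[R] A) (hpi : p ∘ₗ i = LinearMap.id)
    {rs : List R} (h : IsWeaklyRegular B rs) : IsWeaklyRegular A rs := by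
  induction rs generalizing A B with
  | nil => simp
  | cons r rs ih =>
    rw [isWeaklyRegular_cons_iff] at h ⊢
    have hi : Function.Injective i :=
      Function.LeftInverse.injective (g := p) fun a ↦ LinearMap.congr_fun hpi a
    refine ⟨fun a b hab ↦ hi (h.1 ?_), ih (QuotSMulTop.map r i) (QuotSMulTop.map r p) ?_ h.2⟩
    · simpa using congrArg i hab
    · rw [← QuotSMulTop.map_comp, hpi, QuotSMulTop.map_id]

lemma Module.length_le_supportDim_of_isRegular {M : Type*} [AddCommGroup M] [Module R M]
    [Module.Finite R M] {rs : List R} (h : IsRegular M rs) :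
    (rs.length : WithBot ℕ∞) ≤ Module.supportDim R M := by
  induction rs generalizing M with
  | nil =>
    have : Nontrivial M := h.nontrivial
    have hne := Module.supportDim_ne_bot_of_nontrivial R M
    rw [← WithBot.coe_unbot _ hne]
    exact WithBot.coe_le_coe.mpr zero_le
  | cons r rs ih =>
    rw [isRegular_cons_iff] at h
    calc ((r :: rs).length : WithBot ℕ∞) = rs.length + 1 := by simp
      _ ≤ Module.supportDim R (QuotSMulTop r M) + 1 := by gcongr; exact ih h.2
      _ ≤ _ := Module.supportDim_quotSMulTop_succ_le_of_notMem_minimalPrimes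
        fun _ ↦ h.1.notMem_of_mem_minimalPrimes

end Retracts

section Integral

lemma ringKrullDim_le_of_isIntegral_of_injective {A B : Type*} [CommRing A] [CommRing B]
    {f : A →+* B} (hf : f.IsIntegral) (hinj : Function.Injective f) :
    ringKrullDim A ≤ ringKrullDim B := by
  algebraize [f]
  refine iSup_le fun l ↦ ?_
  obtain ⟨P, hP⟩ := hf.comap_surjective hinj l.head
  have : P.asIdeal.LiesOver l.head.asIdeal := ⟨congrArg PrimeSpectrum.asIdeal hP.symm⟩
  obtain ⟨L, hL, -, -⟩ := Ideal.exists_ltSeries_of_hasGoingUp l P.asIdeal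
  exact hL ▸ le_iSup (fun p : LTSeries (PrimeSpectrum B) ↦ (p.length : WithBot ℕ∞)) L

end Integral

section Graded

variable {S : Type*} [CommRing S] (𝒮 : ℕ → AddSubgroup S) [GradedRing 𝒮]

lemma smul_mem_irrelevant {W : Type*} [Group W] [MulSemiringAction W S]
    (hdegS : ∀ (w : W) (i : ℕ) (x : S), x ∈ 𝒮 i → w • x ∈ 𝒮 i) (w : W) {x : S}
    (hx : x ∈ (HomogeneousIdeal.irrelevant 𝒮).toIdeal) :
    w • x ∈ (HomogeneousIdeal.irrelevant 𝒮).toIdeal := by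
  classical
  have hx0 : (DirectSum.decompose 𝒮 x 0 : S) = 0 := hx
  rw [← DirectSum.sum_support_decompose 𝒮 x, Finset.smul_sum]
  refine Ideal.sum_mem _ fun i hi ↦ ?_
  have hi0 : 0 < i := by
    rw [pos_iff_ne_zero]
    rintro rfl
    simp only [DFinsupp.mem_support_toFun] at hi
    exact hi (Subtype.ext hx0)
  exact HomogeneousIdeal.mem_irrelevant_of_mem 𝒮 hi0 (hdegS w i _ (SetLike.coe_mem _))

variable {M : Type*} [AddCommGroup M] [Module S M]

/-- Multiplication by elements of the irrelevant ideal raises the order of vanishing. -/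
lemma decompose_smul_eq_zero_of_mem_irrelevant (ℳ : ℕ → AddSubgroup M)
    [DirectSum.Decomposition ℳ] [SetLike.GradedSMul 𝒮 ℳ] {k : ℕ} {s : S}
    (hs : s ∈ (HomogeneousIdeal.irrelevant 𝒮).toIdeal) {x : M}
    (hx : ∀ i < k, (DirectSum.decompose ℳ x i : M) = 0) (i : ℕ) (hi : i < k + 1) :
    (DirectSum.decompose ℳ (s • x) i : M) = 0 := by
  classical
  have hs0 : (DirectSum.decompose 𝒮 s 0 : S) = 0 := hs
  rw [← DirectSum.sum_support_decompose 𝒮 s, ← DirectSum.sum_support_decompose ℳ x,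
    Finset.sum_smul_sum, DirectSum.decompose_sum, DFinsupp.finsetSum_apply,
    AddSubmonoidClass.coe_finsetSum]
  refine Finset.sum_eq_zero fun a _ ↦ ?_
  rw [DirectSum.decompose_sum, DFinsupp.finsetSum_apply, AddSubmonoidClass.coe_finsetSum]
  refine Finset.sum_eq_zero fun b _ ↦ ?_
  by_cases ha : a = 0
  · subst ha
    simp [hs0]
  by_cases hb : b < k
  · simp [hx b hb]
  · have hmem : (DirectSum.decompose 𝒮 s a : S) • (DirectSum.decompose ℳ x b : M) ∈ ℳ (a + b) :=
      SetLike.GradedSMul.smul_mem (A := 𝒮) (B := ℳ) (i := a) (j := b) (SetLike.coe_mem _)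
        (SetLike.coe_mem _)
    exact DirectSum.decompose_of_mem_ne ℳ hmem (by omega)

/-- Graded Nakayama lemma for submodules over a subring: a nonzero `R`-submodule `N` of an
`ℕ`-graded module satisfies `m N ≠ N` for ideals `m` of `R` inside the irrelevant ideal. -/
lemma smul_top_ne_top_of_le_comap_irrelevant (ℳ : ℕ → AddSubgroup M)
    [DirectSum.Decomposition ℳ] [SetLike.GradedSMul 𝒮 ℳ]
    {R : Type*} [CommRing R] [Algebra R S] [Module R M] [IsScalarTower R S M] {J : Ideal R}
    (hJ : J ≤ (HomogeneousIdeal.irrelevant 𝒮).toIdeal.comap (algebraMap R S))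
    (N : Submodule R M) [Nontrivial N] : J • (⊤ : Submodule R N) ≠ ⊤ := by
  intro htop
  have key (k : ℕ) (x : N) : ∀ i < k, (DirectSum.decompose ℳ (x : M) i : M) = 0 := by
    induction k generalizing x with
    | zero => simp
    | succ k ih =>
      have hx : x ∈ J • (⊤ : Submodule R N) := by rw [htop]; trivial
      induction hx using Submodule.smul_induction_on' with
      | smul r hr n _ =>
        have : ((r • n : N) : M) = algebraMap R S r • (n : M) := by simp
        rw [this]
        exact decompose_smul_eq_zero_of_mem_irrelevant 𝒮 ℳ (hJ hr) (ih n)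
      | add x _ y _ hx hy =>
        intro i hi
        simp [hx i hi, hy i hi]
  obtain ⟨x, hx⟩ := exists_ne (0 : N)
  refine hx (Subtype.ext ((DirectSum.decompose ℳ).injective ?_))
  ext i
  simpa using key (i + 1) x i (Nat.lt_succ_self i)

end Graded

section Invariants

variable {S W : Type*} [CommRing S] [Group W] [Finite W] [MulSemiringAction W S]

/-- A prime ideal containing the invariants of a `W`-stable ideal `I` contains `I`. -/
lemma le_of_map_comap_fixedSubring_le {I : Ideal S} (hI : ∀ (w : W), ∀ x ∈ I, w • x ∈ I)
    (P : Ideal S) (hP : P.IsPrime)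
    (h : (I.comap (fixedSubring W S).subtype).map (algebraMap (fixedSubring W S) S) ≤ P) :
    I ≤ P := by
  classical
  have := Fintype.ofFinite W
  have hsub : (I : Set S) ⊆ ⋃ w ∈ (↑(Finset.univ : Finset W) : Set W),
      P.comap (MulSemiringAction.toRingHom W S w) := by
    intro x hx
    have hfix : ∏ w : W, w • x ∈ fixedSubring W S := fun v ↦ by
      rw [Finset.smul_prod']
      exact Fintype.prod_equiv (Equiv.mulLeft v) _ _ fun w ↦ smul_smul v w x
    have hmem : ∏ w : W, w • x ∈ P := h (Ideal.mem_map_of_mem (algebraMap (fixedSubring W S) S)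
      (x := ⟨_, hfix⟩) (Ideal.prod_mem _ (Finset.mem_univ (1 : W)) (by simpa using hx)))
    obtain ⟨w, -, hw⟩ := hP.prod_mem_iff.mp hmem
    simpa using ⟨w, hw⟩
  rw [Ideal.subset_union_prime 1 1 fun w _ _ _ ↦ Ideal.comap_isPrime _ _] at hsub
  obtain ⟨w, -, hw⟩ := hsub
  intro x hx
  simpa using hw (hI w⁻¹ x hx)

variable {M : Type*} [AddCommGroup M] [Module S M] [DistribMulAction W M]
    (hc : ∀ (w : W) (s : S) (x : M), w • (s • x) = (w • s) • (w • x))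

/-- The Reynolds operator: averaging over `W` retracts `M` onto `M^W`. -/
lemma exists_retraction_fixedSubmodule [Algebra ℚ S] :
    ∃ p : M →ₗ[fixedSubring W S] fixedSubmodule W S M hc,
      p ∘ₗ (fixedSubmodule W S M hc).subtype = LinearMap.id := by
  have := Fintype.ofFinite W
  let c : S := algebraMap ℚ S (Fintype.card W : ℚ)⁻¹
  have hcw (w : W) : w • c = c :=
    RingHom.map_rat_algebraMap (MulSemiringAction.toRingHom W S w) _
  have hcard : c * (Fintype.card W : S) = 1 := by
    rw [← map_natCast (algebraMap ℚ S), ← map_mul, inv_mul_cancel₀ (by simp), map_one]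
  refine ⟨
    { toFun x := ⟨c • ∑ w : W, w • x, fun v ↦ ?_⟩
      map_add' x y := Subtype.ext (by simp [Finset.sum_add_distrib])
      map_smul' r x := Subtype.ext ?_ }, ?_⟩
  · rw [hc, hcw, Finset.smul_sum]
    congr 1
    exact Fintype.sum_equiv (Equiv.mulLeft v) _ _ fun w ↦ smul_smul v w x
  · have hr (w : W) : w • (r • x) = (r : S) • (w • x) := by
      rw [Subring.smul_def, hc, r.2 w]
    simp_rw [hr, ← Finset.smul_sum]
    exact smul_comm c (r : S) (∑ w : W, w • x)
  · ext x
    have hx (w : W) : w • (x : M) = x := x.2 w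
    simp only [LinearMap.comp_apply, Submodule.subtype_apply, LinearMap.coe_mk, AddHom.coe_mk, hx,
      LinearMap.id_apply, Finset.sum_const, Finset.card_univ]
    rw [← Nat.cast_smul_eq_nsmul S, smul_smul, hcard, one_smul]

end Invariants

/-- The dimension of a module does not grow under restriction of scalars along an integral
extension. -/
lemma moduleDim_le_of_isIntegral (R S : Type*) [CommRing R] [CommRing S] [Algebra R S]
    [Algebra.IsIntegral R S] (M : Type*) [AddCommGroup M] [Module S M] [Module R M]
    [IsScalarTower R S M] : moduleDim R M ≤ moduleDim S M := by
  have hann : Module.annihilator R M = (Module.annihilator S M).comap (algebraMap R S) := by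
    ext r
    simp [Module.mem_annihilator]
  unfold moduleDim
  rw [hann]
  exact ringKrullDim_le_of_isIntegral_of_injective
    (RingHom.IsIntegral.quotient _ (algebraMap_isIntegral_iff.mpr inferInstance))
    Ideal.quotientMap_injective

lemma moduleDepth_le_moduleDim (R : Type*) [CommRing R] (I : Ideal R) (M : Type*)
    [AddCommGroup M] [Module R M] [Module.Finite R M] [Nontrivial M] :
    (moduleDepth R I M : WithBot ℕ∞) ≤ moduleDim R M := by
  unfold moduleDim
  rw [← Module.supportDim_eq_ringKrullDim_quotient_annihilator]
  have hne := Module.supportDim_ne_bot_of_nontrivial R M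
  rw [← WithBot.coe_unbot _ hne, WithBot.coe_le_coe]
  refine sSup_le ?_
  rintro _ ⟨rs, -, hrs, rfl⟩
  rw [← WithBot.coe_le_coe, WithBot.coe_unbot]
  exact Module.length_le_supportDim_of_isRegular hrs

/-- Let `S` be a commutative Noetherian ℕ-graded ring with `S⁰ = ℚ`, `W` a
finite group acting on `S` by degree-preserving ring automorphisms, `R = S^W` the invariant
subring, and assume `S` is a finitely generated `R`-module.  Let `M` be a finitely
generated graded `S`-module with a compatible degree-preserving `W`-action.  If `M` is
Cohen-Macaulay over `S`, then `M^W` is Cohen-Macaulay over `R` (whose irrelevant maximal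
ideal is the contraction of the irrelevant maximal ideal `m_S`). -/
theorem fixedSubmodule_isCohenMacaulay
    (S : Type*) [CommRing S] [IsNoetherianRing S] [Algebra ℚ S]
    (𝒮 : ℕ → AddSubgroup S) [GradedRing 𝒮]
    (hS0 : ∀ x : S, x ∈ 𝒮 0 ↔ ∃ q : ℚ, algebraMap ℚ S q = x)
    (W : Type*) [Group W] [Finite W] [MulSemiringAction W S]
    (hdegS : ∀ (w : W) (i : ℕ) (x : S), x ∈ 𝒮 i → w • x ∈ 𝒮 i)
    [Module.Finite (fixedSubring W S) S]
    (M : Type*) [AddCommGroup M] [Module S M] [Module.Finite S M]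
    (ℳ : ℕ → AddSubgroup M) [DirectSum.Decomposition ℳ] [SetLike.GradedSMul 𝒮 ℳ]
    [DistribMulAction W M]
    (hc : ∀ (w : W) (s : S) (x : M), w • (s • x) = (w • s) • (w • x))
    (hdegM : ∀ (w : W) (i : ℕ) (x : M), x ∈ ℳ i → w • x ∈ ℳ i)
    (hM : IsCohenMacaulayModule S (HomogeneousIdeal.irrelevant 𝒮).toIdeal M) :
    IsCohenMacaulayModule (fixedSubring W S)
      (Ideal.comap (fixedSubring W S).subtype (HomogeneousIdeal.irrelevant 𝒮).toIdeal)
      (fixedSubmodule W S M hc) := by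
  obtain hM | hM := hM
  · exact Or.inl inferInstance
  obtain hN | hN := subsingleton_or_nontrivial (fixedSubmodule W S M hc)
  · exact Or.inl hN
  right
  obtain ⟨p, hp⟩ := exists_retraction_fixedSubmodule hc
  have : Module.Finite (fixedSubring W S) M := Module.Finite.trans S M
  have : Module.Finite (fixedSubring W S) (fixedSubmodule W S M hc) :=
    Module.Finite.of_surjective p fun x ↦ ⟨x, LinearMap.congr_fun hp x⟩
  refine le_antisymm (moduleDepth_le_moduleDim _ _ _) ?_
  calc moduleDim (fixedSubring W S) (fixedSubmodule W S M hc)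
      ≤ moduleDim (fixedSubring W S) M := by
        unfold moduleDim
        rw [← Module.supportDim_eq_ringKrullDim_quotient_annihilator,
          ← Module.supportDim_eq_ringKrullDim_quotient_annihilator]
        exact Module.supportDim_le_of_injective _ (Submodule.subtype_injective _)
    _ ≤ moduleDim S M := moduleDim_le_of_isIntegral _ _ _
    _ = moduleDepth S (HomogeneousIdeal.irrelevant 𝒮).toIdeal M := hM.symm
    _ ≤ _ := by
      rw [WithBot.coe_le_coe]
      refine sSup_le_sSup ?_
      rintro _ ⟨rs, hrs, hreg, rfl⟩
      obtain ⟨ts, hts, htreg, htl⟩ := exists_isWeaklyRegular_map_algebraMap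
        (J := (HomogeneousIdeal.irrelevant 𝒮).toIdeal.comap (fixedSubring W S).subtype)
        (Ideal.map_comap_le (f := (fixedSubring W S).subtype))
        (le_of_map_comap_fixedSubring_le fun w _ ↦ smul_mem_irrelevant 𝒮 hdegS w)
        rs.length M rs hrs hreg.toIsWeaklyRegular rfl
      rw [RingTheory.Sequence.isWeaklyRegular_map_algebraMap_iff] at htreg
      refine ⟨ts, hts, ⟨htreg.of_retract _ p hp, Ne.symm ?_⟩, by rw [htl]⟩
      exact smul_top_ne_top_of_le_comap_irrelevant 𝒮 ℳ (Ideal.span_le.mpr hts) _
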